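/- arXiv:2202.05127 — 2 statements merged into one kernel-verified Lean document; each statement's English description precedes it below -/
import Mathlib

section
/- Let G be a finite connected simple graph, let d denote its shortest-path distance, and let s, t be adjacent vertices of G such that d(w,s) ≠ d(w,t) for every vertex w. Let A = {w : d(w,s) = d(w,t) + 1}. Then t ∈ A, s ∉ A, every vertex not in A satisfies d(w,t) = d(w,s) + 1, the subgraph of G induced on A is connected, and the subgraph of G induced on the complement of A is connected. -/
namespace SimpleGraph

variable {V : Type*} {G : SimpleGraph V}

lemma Connected.exists_adj_dist_add_one_eq (hG : G.Connected) {w t : V} (h : w ≠ t) :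
    ∃ v, G.Adj w v ∧ G.dist v t + 1 = G.dist w t := by
  obtain ⟨p, hp⟩ := hG.exists_walk_length_eq_dist w t
  cases p with
  | nil => exact absurd rfl h
  | @cons _ v _ hwv q =>
    refine ⟨v, hwv, ?_⟩
    have hq := dist_le q
    have htri := hG.dist_triangle (u := w) (v := v) (w := t)
    rw [dist_eq_one_iff_adj.2 hwv] at htri
    rw [Walk.length_cons] at hp
    omega

lemma connected_induce_of_exists_adj_lt {S : Set V} {t : V} (ht : t ∈ S) (f : V → ℕ)
    (h : ∀ w ∈ S, w ≠ t → ∃ v ∈ S, G.Adj w v ∧ f v < f w) : (G.induce S).Connected := by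
  have reach : ∀ n, ∀ w (hw : w ∈ S), f w = n → (G.induce S).Reachable ⟨w, hw⟩ ⟨t, ht⟩ := by
    intro n
    induction n using Nat.strong_induction_on with
    | _ n ih =>
      rintro w hw rfl
      by_cases hwt : w = t
      · subst hwt
        rfl
      · obtain ⟨v, hv, hadj, hlt⟩ := h w hw hwt
        have hadj' : (G.induce S).Adj ⟨w, hw⟩ ⟨v, hv⟩ := hadj
        exact hadj'.reachable.trans (ih _ hlt v hv rfl)
  have : Nonempty S := ⟨⟨t, ht⟩⟩
  exact ⟨fun x y ↦ (reach _ x.1 x.2 rfl).trans (reach _ y.1 y.2 rfl).symm⟩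

/-- The vertices strictly closer to `t` than to its neighbor `s` induce a connected subgraph. -/
lemma Connected.connected_induce_dist_eq_dist_add_one (hG : G.Connected) {s t : V}
    (hst : G.Adj s t) : (G.induce {w | G.dist w s = G.dist w t + 1}).Connected := by
  refine connected_induce_of_exists_adj_lt (t := t) ?_ (G.dist · t) fun w hw hwt ↦ ?_
  · simpa using dist_eq_one_iff_adj.2 hst.symm
  · obtain ⟨v, hadj, hv⟩ := hG.exists_adj_dist_add_one_eq hwt
    refine ⟨v, ?_, hadj, by omega⟩
    have hwvs := hG.dist_triangle (u := w) (v := v) (w := s)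
    have hvts := hG.dist_triangle (u := v) (v := t) (w := s)
    rw [dist_eq_one_iff_adj.2 hadj] at hwvs
    rw [dist_eq_one_iff_adj.2 hst.symm] at hvts
    simp only [Set.mem_ofPred_eq] at hw ⊢
    omega

end SimpleGraph

/-- The cut `A = {w | d(w,s) = d(w,t) + 1}` and its complement each induce a
connected subgraph (Corollary 1 of the paper). -/
theorem stmt_1 {V : Type*} [Fintype V] (G : SimpleGraph V) (hG : G.Connected)
    (s t : V) (hst : G.Adj s t)
    (hne : ∀ w : V, G.dist w s ≠ G.dist w t)
    (A : Set V) (hA : A = {w : V | G.dist w s = G.dist w t + 1}) :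
    t ∈ A ∧ s ∉ A ∧ (∀ w : V, w ∉ A → G.dist w t = G.dist w s + 1) ∧
    (G.induce A).Connected ∧ (G.induce Aᶜ).Connected := by
  subst hA
  have hcompl : ∀ w, ¬ G.dist w s = G.dist w t + 1 ↔ G.dist w t = G.dist w s + 1 := by
    intro w
    have hwst := hG.dist_triangle (u := w) (v := s) (w := t)
    have hwts := hG.dist_triangle (u := w) (v := t) (w := s)
    rw [SimpleGraph.dist_eq_one_iff_adj.2 hst] at hwst
    rw [SimpleGraph.dist_eq_one_iff_adj.2 hst.symm] at hwts
    have := hne w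
    omega
  refine ⟨?_, ?_, fun w ↦ (hcompl w).1, hG.connected_induce_dist_eq_dist_add_one hst, ?_⟩
  · simpa using SimpleGraph.dist_eq_one_iff_adj.2 hst.symm
  · simp
  · have hset : {w | G.dist w s = G.dist w t + 1}ᶜ = {w | G.dist w t = G.dist w s + 1} :=
      Set.ext hcompl
    rw [hset]
    exact hG.connected_induce_dist_eq_dist_add_one hst.symm
end

section
/- Fix an integer k' ≥ 2 and let H be the graph with vertex set {r} ∪ {v_{i,j} : 1 ≤ j ≤ i ≤ k'} ∪ {q_t : 1 ≤ t ≤ k'} and edge set consisting exactly of: {r, v_{i,1}} for every 1 ≤ i ≤ k'; {v_{i,j}, v_{i,j+1}} for all 1 ≤ j < i ≤ k'; {v_{i,i}, v_{i+1,i+1}} for all 1 ≤ i < k'; {v_{k',k'}, q_1}; {q_t, q_{t+1}} for all 1 ≤ t < k'; and {q_{k'}, v_{1,1}}. Then H is connected and for all indices with 1 ≤ j < i ≤ k', the shortest-path distance d of H satisfies: d(v_{i,j}, v_{t,t}) = j + t for 1 ≤ t ≤ i − j; d(v_{i,j}, v_{t,t}) = 2i − j − t for i − j ≤ t ≤ i;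 d(v_{i,j}, v_{t,t}) = t − j for i ≤ t ≤ k'; d(v_{i,j}, q_t) = k' + t − j for 1 ≤ t ≤ j + 1; and d(v_{i,j}, q_t) = k' + j + 2 − t for j + 1 ≤ t ≤ k'. -/
/-- Vertex set of the S-Halin graph of Lemma 11: the root `r`, the tree vertices
`v_{i,j}` with `1 ≤ j ≤ i ≤ k'`, and the path vertices `q_t` with `1 ≤ t ≤ k'`. -/
def HV (k' : ℕ) : Type :=
  Unit ⊕ {p : ℕ × ℕ // 1 ≤ p.2 ∧ p.2 ≤ p.1 ∧ p.1 ≤ k'} ⊕ {t : ℕ // 1 ≤ t ∧ t ≤ k'}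

/-- The root vertex `r`. -/
def rV (k' : ℕ) : HV k' := Sum.inl ()

/-- The tree vertex `v_{i,j}`. -/
def vV (k' i j : ℕ) (h : 1 ≤ j ∧ j ≤ i ∧ i ≤ k') : HV k' :=
  Sum.inr (Sum.inl ⟨(i, j), h⟩)

/-- The path vertex `q_t`. -/
def qV (k' t : ℕ) (h : 1 ≤ t ∧ t ≤ k') : HV k' := Sum.inr (Sum.inr ⟨t, h⟩)

/-- The base (asymmetric) adjacency relation listing exactly the edges of the
S-Halin graph of Lemma 11. -/
def HRel (k' : ℕ) : HV k' → HV k' → Prop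
  | Sum.inl _, Sum.inr (Sum.inl ⟨(_, j), _⟩) => j = 1
  | Sum.inr (Sum.inl ⟨(i, j), _⟩), Sum.inr (Sum.inl ⟨(i', j'), _⟩) =>
      (i' = i ∧ j' = j + 1) ∨ (j = i ∧ j' = i' ∧ i' = i + 1)
  | Sum.inr (Sum.inl ⟨(i, j), _⟩), Sum.inr (Sum.inr ⟨t, _⟩) =>
      (i = k' ∧ j = k' ∧ t = 1) ∨ (i = 1 ∧ j = 1 ∧ t = k')
  | Sum.inr (Sum.inr ⟨t, _⟩), Sum.inr (Sum.inr ⟨t', _⟩) => t' = t + 1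
  | _, _ => False

/-- The S-Halin graph `H` of Lemma 11. -/
def H (k' : ℕ) : SimpleGraph (HV k') := SimpleGraph.fromRel (HRel k')

namespace SimpleGraph

variable {V : Type*} {G : SimpleGraph V} {u v w : V}

theorem Adj.edist_le_one (h : G.Adj u v) : G.edist u v ≤ (1 : ℕ) := by
  simpa using (edist_eq_one_iff_adj.mpr h).le

theorem edist_le_trans {m n l : ℕ} (h₁ : G.edist u v ≤ m) (h₂ : G.edist v w ≤ n)
    (h : m + n = l) : G.edist u w ≤ l := by
  subst h
  push_cast
  exact G.edist_triangle.trans (add_le_add h₁ h₂)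

theorem reachable_of_edist_le {n : ℕ} (h : G.edist u v ≤ n) : G.Reachable u v :=
  edist_ne_top_iff_reachable.mp (ne_top_of_le_ne_top (ENat.natCast_ne_top n) h)

theorem dist_le_of_edist_le {n : ℕ} (h : G.edist u v ≤ n) : G.dist u v ≤ n :=
  ENat.toNat_le_of_le_natCast h

theorem Walk.sub_le_length {f : V → ℤ} (hf : ∀ a b, G.Adj a b → f b ≤ f a + 1)
    (p : G.Walk u v) : f v - f u ≤ p.length := by
  induction p with
  | nil => simp
  | cons h _ ih =>
    have := hf _ _ h
    rw [Walk.length_cons]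
    push_cast
    linarith

/-- A function changing by at most one along edges bounds the distance from below. -/
theorem dist_eq_of_edist_le {f : V → ℤ} (hf : ∀ a b, G.Adj a b → f b ≤ f a + 1) {n : ℕ}
    (h : G.edist u v ≤ n) (hn : (n : ℤ) ≤ f v - f u) : G.dist u v = n := by
  refine (dist_le_of_edist_le h).antisymm ?_
  obtain ⟨p, hp⟩ := (reachable_of_edist_le h).exists_walk_length_eq_dist
  have := p.sub_le_length hf
  omega

end SimpleGraph

open SimpleGraph

section Adjacency

variable {k i j t : ℕ}

theorem H_adj_of_rel {x y : HV k} (h : HRel k x y) (hne : x ≠ y) : (H k).Adj x y :=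
  (fromRel_adj _ _ _).mpr ⟨hne, Or.inl h⟩

theorem vV_ne {i' j' : ℕ} (h h') (hne : i ≠ i' ∨ j ≠ j') : vV k i j h ≠ vV k i' j' h' := by
  intro he
  have := congrArg Subtype.val (Sum.inl.inj (Sum.inr.inj he))
  simp only [Prod.mk.injEq] at this
  omega

theorem H_adj_root (h) : (H k).Adj (rV k) (vV k i 1 h) :=
  H_adj_of_rel (show 1 = 1 from rfl) Sum.inl_ne_inr

theorem H_adj_branch (h h') : (H k).Adj (vV k i j h) (vV k i (j + 1) h') :=
  H_adj_of_rel (Or.inl ⟨rfl, rfl⟩) (vV_ne _ _ (by omega))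

theorem H_adj_diag (h h') : (H k).Adj (vV k i i h) (vV k (i + 1) (i + 1) h') :=
  H_adj_of_rel (Or.inr ⟨rfl, rfl, rfl⟩) (vV_ne _ _ (by omega))

theorem H_adj_last_first (h h') : (H k).Adj (vV k k k h) (qV k 1 h') :=
  H_adj_of_rel (Or.inl ⟨rfl, rfl, rfl⟩) fun he => Sum.inl_ne_inr (Sum.inr.inj he)

theorem H_adj_first_last (h h') : (H k).Adj (vV k 1 1 h) (qV k k h') :=
  H_adj_of_rel (Or.inr ⟨rfl, rfl, rfl⟩) fun he => Sum.inl_ne_inr (Sum.inr.inj he)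

theorem H_adj_path (h h') : (H k).Adj (qV k t h) (qV k (t + 1) h') := by
  refine H_adj_of_rel (show t + 1 = t + 1 from rfl) fun he => ?_
  have := congrArg Subtype.val (Sum.inr.inj (Sum.inr.inj he))
  simp only at this
  omega

end Adjacency

section UpperBounds

variable {k i j a b s t : ℕ}

theorem edist_branch_le (h h') (hjb : j ≤ b) :
    (H k).edist (vV k i j h) (vV k i b h') ≤ (b - j : ℕ) := by
  induction b, hjb using Nat.le_induction with
  | base => simp
  | succ b hb ih =>
    exact edist_le_trans (ih ⟨by omega, by omega, by omega⟩)
      (H_adj_branch _ _).edist_le_one (by omega)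

theorem edist_diag_le (h h') (hab : a ≤ b) :
    (H k).edist (vV k a a h) (vV k b b h') ≤ (b - a : ℕ) := by
  induction b, hab using Nat.le_induction with
  | base => simp
  | succ b hb ih =>
    exact edist_le_trans (ih ⟨by omega, by omega, by omega⟩)
      (H_adj_diag _ _).edist_le_one (by omega)

theorem edist_path_le (h h') (hst : s ≤ t) :
    (H k).edist (qV k s h) (qV k t h') ≤ (t - s : ℕ) := by
  induction t, hst using Nat.le_induction with
  | base => simp
  | succ t ht ih =>
    exact edist_le_trans (ih ⟨by omega, by omega⟩) (H_adj_path _ _).edist_le_one (by omega)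

theorem edist_root_le (h) : (H k).edist (rV k) (vV k i j h) ≤ j :=
  edist_le_trans (H_adj_root ⟨le_rfl, by omega, by omega⟩).edist_le_one
    (edist_branch_le _ _ h.1) (by omega)

theorem edist_le_via_root (h h') : (H k).edist (vV k i j h) (vV k a b h') ≤ (j + b : ℕ) :=
  edist_le_trans (edist_comm.trans_le (edist_root_le h)) (edist_root_le h') rfl

theorem edist_path_le_of_edist_last_le {x : HV k} {n l : ℕ} (h h')
    (hx : (H k).edist x (vV k k k h) ≤ n) (hl : n + t = l) :
    (H k).edist x (qV k t h') ≤ l :=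
  edist_le_trans hx (edist_le_trans (H_adj_last_first h ⟨le_rfl, by omega⟩).edist_le_one
    (edist_path_le _ h' h'.1) rfl) (by omega)

theorem H_connected (hk : 1 ≤ k) : (H k).Connected := by
  refine (connected_iff_exists_forall_reachable _).mpr ⟨rV k, ?_⟩
  rintro (⟨⟩ | ⟨⟨i, j⟩, h⟩ | ⟨t, h⟩)
  · exact Reachable.refl _
  · exact reachable_of_edist_le (edist_root_le h)
  · exact reachable_of_edist_le
      (edist_path_le_of_edist_last_le ⟨hk, le_rfl, le_rfl⟩ h (edist_root_le _) rfl)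

end UpperBounds

/-- The distance in `H k` from `v_{i,j}` with `j < i`, as an explicit function. -/
def distFormula (k i j : ℕ) : HV k → ℤ
  | Sum.inl _ => j
  | Sum.inr (Sum.inl ⟨(a, b), _⟩) =>
      if a = i then max ((b : ℤ) - j) (j - b)
      else min ((j : ℤ) + b) (i - j + max ((a : ℤ) - i) (i - a) + (a - b))
  | Sum.inr (Sum.inr ⟨t, _⟩) => min ((k : ℤ) + t - j) (k + j + 2 - t)

theorem distFormula_le_of_adj {k i j : ℕ} (h1 : 1 ≤ j) (h2 : j < i) (h3 : i ≤ k) (x y : HV k)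
    (h : (H k).Adj x y) : distFormula k i j y ≤ distFormula k i j x + 1 := by
  obtain ⟨-, h⟩ := (fromRel_adj _ _ _).mp h
  rcases x with ⟨⟩ | ⟨⟨a, b⟩, hx⟩ | ⟨t, hx⟩ <;> rcases y with ⟨⟩ | ⟨⟨c, d⟩, hy⟩ | ⟨s, hy⟩ <;>
    simp only [HRel, or_false, false_or] at h <;> simp only [distFormula] <;>
    (try split_ifs) <;> omega

/-- Lemma 11 of the paper (distance computations): the graph `H` is connected and
the distances from `v_{i,j}` (with `1 ≤ j < i ≤ k'`) to the boundary vertices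
`v_{t,t}` and `q_t` are as claimed. -/
theorem stmt_13 (k' : ℕ) (hk : 2 ≤ k') :
    (H k').Connected ∧
    ∀ (i j : ℕ) (h1 : 1 ≤ j) (h2 : j < i) (h3 : i ≤ k'),
      (∀ (t : ℕ) (ht1 : 1 ≤ t) (ht2 : t ≤ i - j),
        (H k').dist (vV k' i j ⟨by omega, by omega, by omega⟩)
          (vV k' t t ⟨by omega, by omega, by omega⟩) = j + t) ∧
      (∀ (t : ℕ) (ht1 : i - j ≤ t) (ht2 : t ≤ i),
        (H k').dist (vV k' i j ⟨by omega, by omega, by omega⟩)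
          (vV k' t t ⟨by omega, by omega, by omega⟩) = 2 * i - j - t) ∧
      (∀ (t : ℕ) (ht1 : i ≤ t) (ht2 : t ≤ k'),
        (H k').dist (vV k' i j ⟨by omega, by omega, by omega⟩)
          (vV k' t t ⟨by omega, by omega, by omega⟩) = t - j) ∧
      (∀ (t : ℕ) (ht1 : 1 ≤ t) (ht2 : t ≤ j + 1),
        (H k').dist (vV k' i j ⟨by omega, by omega, by omega⟩)
          (qV k' t ⟨by omega, by omega⟩) = k' + t - j) ∧
      (∀ (t : ℕ) (ht1 : j + 1 ≤ t) (ht2 : t ≤ k'),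
        (H k').dist (vV k' i j ⟨by omega, by omega, by omega⟩)
          (qV k' t ⟨by omega, by omega⟩) = k' + j + 2 - t) := by
  refine ⟨H_connected (by omega), fun i j h1 h2 h3 => ?_⟩
  have hf := distFormula_le_of_adj h1 h2 h3
  have hi : (H k').edist (vV k' i j ⟨h1, h2.le, h3⟩) (vV k' i i ⟨by omega, le_rfl, h3⟩) ≤
    (i - j : ℕ) := edist_branch_le _ _ h2.le
  have hlast : (H k').edist (vV k' i j ⟨h1, h2.le, h3⟩)
      (vV k' k' k' ⟨by omega, le_rfl, le_rfl⟩) ≤ (k' - j : ℕ) :=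
    edist_le_trans hi (edist_diag_le _ _ h3) (by omega)
  refine ⟨fun t ht1 ht2 => ?_, fun t ht1 ht2 => ?_, fun t ht1 ht2 => ?_, fun t ht1 ht2 => ?_,
    fun t ht1 ht2 => ?_⟩
  · refine dist_eq_of_edist_le hf (edist_le_via_root _ _) ?_
    simp only [distFormula, vV]
    split_ifs <;> omega
  · refine dist_eq_of_edist_le hf
      (edist_le_trans hi (edist_comm.trans_le (edist_diag_le _ _ ht2)) (by omega)) ?_
    simp only [distFormula, vV]
    split_ifs <;> omega
  · refine dist_eq_of_edist_le hf (edist_le_trans hi (edist_diag_le _ _ ht1) (by omega)) ?_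
    simp only [distFormula, vV]
    split_ifs <;> omega
  · refine dist_eq_of_edist_le hf
      (edist_path_le_of_edist_last_le _ ⟨ht1, by omega⟩ hlast (by omega)) ?_
    simp only [distFormula, vV, qV]
    split_ifs <;> omega
  · refine dist_eq_of_edist_le hf (edist_le_trans (edist_le_via_root _ _)
      (edist_le_trans
        (H_adj_first_last ⟨le_rfl, le_rfl, by omega⟩ ⟨by omega, le_rfl⟩).edist_le_one
        (edist_comm.trans_le (edist_path_le ⟨by omega, ht2⟩ _ ht2)) rfl) (by omega)) ?_
    simp only [distFormula, vV, qV]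
    split_ifs <;> omega
end
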